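/- (Generalization bound for Lipschitz rewards.) Let S, U be finite nonempty sets, γ ∈ (0,1), φ : S → ℝ^k, W_R ∈ ℝ^{d×k}, and let f : (ℝ^d)^n → ℝ^d be coordinatewise Lipschitz with constants L₁,…,Lₙ ≥ 0 with respect to the ℓ^∞ norm (for tuples differing in one component i, ‖f(T) − f(T')‖_∞ ≤ L_i ‖T_i − T'_i‖_∞). For capability tuples T^x, T^y define rewards R_x(s) = ⟨f(T^x), W_R φ(s)⟩ and R_y(s) = ⟨f(T^y), W_R φ(s)⟩, and let P be a single transition kernel (independent of the capabilities). Let Q_x, Q_y satisfy the Bellman optimality equations for (R_x, P) and (R_y, P) respectively. Then for any initial distribution ρ, |V*_x − V*_y| ≤ (s_max Σ_{i=1}^n L_i ‖T^x_i − T^y_i‖_∞)/(γ(1 − γ)), where s_max = max_s ‖W_R φ(s)‖₁ and V*_x = Σ_s ρ(s) max_u Q_x(s,u), V*_y = Σ_s ρ(s) max_u Q_y(s,u). -/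

import Mathlib

/-- ℓ^∞ norm on ℝ^d. -/
noncomputable def linf {d : ℕ} (x : Fin d → ℝ) : ℝ := ⨆ j, |x j|

/-- Euclidean inner product on ℝ^d. -/
def dot {d : ℕ} (x y : Fin d → ℝ) : ℝ := ∑ j, x j * y j

/-- ℓ¹ norm on ℝ^k. -/
def l1 {k : ℕ} (x : Fin k → ℝ) : ℝ := ∑ j, |x j|

theorem aux_abs_le_linf {d : ℕ} (x : Fin d → ℝ) (j : Fin d) : |x j| ≤ linf x :=
  le_ciSup (f := fun j => |x j|) (Set.finite_range _).bddAbove j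

theorem aux_linf_nonneg {d : ℕ} (x : Fin d → ℝ) : 0 ≤ linf x :=
  Real.iSup_nonneg fun _ => abs_nonneg _

theorem aux_hybrid {d n : ℕ}
    (f : (Fin n → Fin d → ℝ) → Fin d → ℝ) (L : Fin n → ℝ)
    (hf : ∀ (i : Fin n) (T T' : Fin n → Fin d → ℝ), (∀ j, j ≠ i → T j = T' j) →
      linf (fun m => f T m - f T' m) ≤ L i * linf (fun m => T i m - T' i m))
    (Tx Ty : Fin n → Fin d → ℝ) (m : Fin d) (A : Finset (Fin n)) :
    |f (A.piecewise Tx Ty) m - f Ty m| ≤ ∑ i ∈ A, L i * linf (fun m => Tx i m - Ty i m) := by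
  induction A using Finset.induction_on with
  | empty => simp
  | insert a A ha ih =>
    rw [Finset.sum_insert ha]
    have h1 := hf a ((insert a A).piecewise Tx Ty) (A.piecewise Tx Ty) (fun j hj => by
      simp [Finset.piecewise, hj])
    have h2 := aux_abs_le_linf
      (fun m => f ((insert a A).piecewise Tx Ty) m - f (A.piecewise Tx Ty) m) m
    rw [Finset.piecewise_eq_of_mem _ _ _ (Finset.mem_insert_self a A),
      Finset.piecewise_eq_of_notMem _ _ _ ha] at h1
    have h3 := abs_sub_le (f ((insert a A).piecewise Tx Ty) m) (f (A.piecewise Tx Ty) m) (f Ty m)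
    linarith

theorem aux_iSup_sub {U : Type*} [Fintype U] [Nonempty U] (a b : U → ℝ) (c : ℝ)
    (h : ∀ u, a u - b u ≤ c) : (⨆ u, a u) - (⨆ u, b u) ≤ c := by
  have : (⨆ u, a u) ≤ c + ⨆ u, b u := ciSup_le fun u => by
    have := le_ciSup (Set.finite_range b).bddAbove u
    linarith [h u]
  linarith

theorem aux_avg {S : Type*} [Fintype S] (p x y : S → ℝ) (c : ℝ) (hp : ∀ s, 0 ≤ p s)
    (hs : ∑ s, p s = 1) (h : ∀ s, |x s - y s| ≤ c) :
    |(∑ s, p s * x s) - ∑ s, p s * y s| ≤ c := by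
  rw [← Finset.sum_sub_distrib]
  calc _ ≤ ∑ s, |p s * x s - p s * y s| := Finset.abs_sum_le_sum_abs _ _
    _ ≤ ∑ s, p s * c := Finset.sum_le_sum fun s _ => by
        rw [← mul_sub, abs_mul, abs_of_nonneg (hp s)]
        exact mul_le_mul_of_nonneg_left (h s) (hp s)
    _ = c := by rw [← Finset.sum_mul, hs, one_mul]

/-- Generalisation bound for rewards that are coordinatewise Lipschitz in the agents'
capabilities (transition kernel shared across capability tuples). -/
theorem lipschitz_reward_generalisation
    {S U : Type*} [Fintype S] [Nonempty S] [Fintype U] [Nonempty U]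
    {k d n : ℕ} (γ : ℝ) (hγ0 : 0 < γ) (hγ1 : γ < 1)
    (φ : S → Fin k → ℝ) (WR : Matrix (Fin d) (Fin k) ℝ)
    (f : (Fin n → Fin d → ℝ) → Fin d → ℝ) (L : Fin n → ℝ) (hL : ∀ i, 0 ≤ L i)
    (hf : ∀ (i : Fin n) (T T' : Fin n → Fin d → ℝ), (∀ j, j ≠ i → T j = T' j) →
      linf (fun m => f T m - f T' m) ≤ L i * linf (fun m => T i m - T' i m))
    (Tx Ty : Fin n → Fin d → ℝ)
    (Rx Ry : S → ℝ)
    (hRx : ∀ s, Rx s = dot (f Tx) (WR.mulVec (φ s)))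
    (hRy : ∀ s, Ry s = dot (f Ty) (WR.mulVec (φ s)))
    (P : S → U → S → ℝ)
    (hPpos : ∀ s u s', 0 ≤ P s u s') (hPsum : ∀ s u, ∑ s', P s u s' = 1)
    (Qx Qy : S → U → ℝ)
    (hQx : ∀ s u, Qx s u = Rx s + γ * ∑ s', P s u s' * (⨆ u', Qx s' u'))
    (hQy : ∀ s u, Qy s u = Ry s + γ * ∑ s', P s u s' * (⨆ u', Qy s' u'))
    (ρ : S → ℝ) (hρpos : ∀ s, 0 ≤ ρ s) (hρsum : ∑ s, ρ s = 1) :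
    |(∑ s, ρ s * (⨆ u, Qx s u)) - ∑ s, ρ s * (⨆ u, Qy s u)| ≤
      (⨆ s, l1 (WR.mulVec (φ s))) * (∑ i, L i * linf (fun m => Tx i m - Ty i m)) /
        (γ * (1 - γ)) := by
  set D := ∑ i, L i * linf (fun m => Tx i m - Ty i m) with hD
  set M := ⨆ s, l1 (WR.mulVec (φ s)) with hM
  have hD0 : 0 ≤ D := Finset.sum_nonneg fun i _ => mul_nonneg (hL i) (aux_linf_nonneg _)
  have hM0 : 0 ≤ M := Real.iSup_nonneg fun s => Finset.sum_nonneg fun _ _ => abs_nonneg _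
  have hfD : ∀ m, |f Tx m - f Ty m| ≤ D := fun m => by
    have := aux_hybrid f L hf Tx Ty m Finset.univ
    rwa [Finset.piecewise_univ] at this
  have hR : ∀ s, |Rx s - Ry s| ≤ M * D := fun s => by
    have h1 : l1 (WR.mulVec (φ s)) ≤ M :=
      le_ciSup (f := fun s => l1 (WR.mulVec (φ s))) (Set.finite_range _).bddAbove s
    rw [hRx, hRy]
    unfold dot
    rw [← Finset.sum_sub_distrib]
    calc _ ≤ _ := Finset.abs_sum_le_sum_abs _ _
      _ ≤ ∑ j, |WR.mulVec (φ s) j| * D := Finset.sum_le_sum fun j _ => by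
          rw [← sub_mul, abs_mul, mul_comm]
          exact mul_le_mul_of_nonneg_left (hfD j) (abs_nonneg _)
      _ = l1 (WR.mulVec (φ s)) * D := by rw [l1, Finset.sum_mul]
      _ ≤ M * D := mul_le_mul_of_nonneg_right h1 hD0
  obtain ⟨s0, hs0⟩ := Finite.exists_max (fun s => |(⨆ u, Qx s u) - ⨆ u, Qy s u|)
  set B := |(⨆ u, Qx s0 u) - ⨆ u, Qy s0 u| with hB
  have hQ : ∀ s u, |Qx s u - Qy s u| ≤ M * D + γ * B := fun s u => by
    have h1 := aux_avg (P s u) _ _ B (hPpos s u) (hPsum s u) hs0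
    have h2 := hR s
    rw [hQx, hQy]
    rw [abs_le] at h1 h2 ⊢
    constructor <;> nlinarith [h1.1, h1.2, h2.1, h2.2]
  have hBB : B ≤ M * D + γ * B := by
    rw [hB, abs_le]
    have h1 := aux_iSup_sub (Qx s0) (Qy s0) _ fun u => (abs_le.1 (hQ s0 u)).2
    have h2 := aux_iSup_sub (Qy s0) (Qx s0) (M * D + γ * B) fun u => by
      linarith [(abs_le.1 (hQ s0 u)).1]
    exact ⟨by linarith, h1⟩
  refine (aux_avg ρ _ _ B hρpos hρsum hs0).trans ?_
  rw [le_div_iff₀ (mul_pos hγ0 (by linarith))]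
  have h0 : 0 ≤ M * D := mul_nonneg hM0 hD0
  nlinarith
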